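/- arXiv:2108.05873 — 2 statements merged into one kernel-verified Lean document; each statement's English description precedes it below -/
import Mathlib

section
/- Let A be an m×n complex matrix, M an invertible Hermitian m×m matrix and N an invertible Hermitian n×n matrix. Define the weighted adjoint A^[*] = N⁻¹ A* M. Then there exists a unique matrix X (the weighted Moore-Penrose inverse A^[†], satisfying AXA=A, XAX=X, (AX)^[*]=AX with respect to weight M, and (XA)^[*]=XA with respect to weight N) if and only if rank(A) = rank(A A^[*]) = rank(A^[*] A). -/
open Matrix

/-- The weighted (MN-) adjoint `A^[*] = N⁻¹ Aᴴ M` of a matrix between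
indefinite inner product spaces with weights `M` (output) and `N` (input). -/
noncomputable def wadj {m n : ℕ} (M : Matrix (Fin m) (Fin m) ℂ)
    (N : Matrix (Fin n) (Fin n) ℂ) (A : Matrix (Fin m) (Fin n) ℂ) :
    Matrix (Fin n) (Fin m) ℂ := N⁻¹ * Aᴴ * M

/-- `X` is the weighted Moore-Penrose inverse of `A` w.r.t. weights `M`, `N`:
the four weighted Penrose equations. -/
def IsWMP {m n : ℕ} (M : Matrix (Fin m) (Fin m) ℂ)
    (N : Matrix (Fin n) (Fin n) ℂ) (A : Matrix (Fin m) (Fin n) ℂ)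
    (X : Matrix (Fin n) (Fin m) ℂ) : Prop :=
  A * X * A = A ∧ X * A * X = X ∧
    wadj M M (A * X) = A * X ∧ wadj N N (X * A) = X * A

lemma wadj_mul' {m n p : ℕ} (M : Matrix (Fin m) (Fin m) ℂ) (N : Matrix (Fin n) (Fin n) ℂ)
    (P : Matrix (Fin p) (Fin p) ℂ) (hNu : IsUnit N)
    (A : Matrix (Fin m) (Fin n) ℂ) (B : Matrix (Fin n) (Fin p) ℂ) :
    wadj M P (A * B) = wadj N P B * wadj M N A := by
  have hd : IsUnit N.det := (Matrix.isUnit_iff_isUnit_det N).1 hNu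
  have h : N * (N⁻¹ * (Aᴴ * M)) = Aᴴ * M := by
    rw [← Matrix.mul_assoc, Matrix.mul_nonsing_inv _ hd, Matrix.one_mul]
  simp only [wadj, Matrix.conjTranspose_mul, Matrix.mul_assoc, h]

lemma wadj_wadj' {m n : ℕ} (M : Matrix (Fin m) (Fin m) ℂ) (N : Matrix (Fin n) (Fin n) ℂ)
    (hM : M.IsHermitian) (hMu : IsUnit M) (hN : N.IsHermitian) (hNu : IsUnit N)
    (A : Matrix (Fin m) (Fin n) ℂ) : wadj N M (wadj M N A) = A := by
  have hd : IsUnit N.det := (Matrix.isUnit_iff_isUnit_det N).1 hNu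
  have hd2 : IsUnit M.det := (Matrix.isUnit_iff_isUnit_det M).1 hMu
  simp only [wadj, Matrix.conjTranspose_mul, Matrix.conjTranspose_conjTranspose,
    Matrix.conjTranspose_nonsing_inv, hM.eq, hN.eq]
  rw [← Matrix.mul_assoc, Matrix.nonsing_inv_mul _ hd2, Matrix.one_mul, Matrix.mul_assoc,
    Matrix.nonsing_inv_mul _ hd, Matrix.mul_one]

open scoped ComplexOrder in
lemma wadj_rank' {m n : ℕ} (M : Matrix (Fin m) (Fin m) ℂ) (N : Matrix (Fin n) (Fin n) ℂ)
    (hM : M.IsHermitian) (hMu : IsUnit M) (hN : N.IsHermitian) (hNu : IsUnit N)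
    (A : Matrix (Fin m) (Fin n) ℂ) : (wadj M N A).rank = A.rank := by
  have key : ∀ {m n : ℕ} (M : Matrix (Fin m) (Fin m) ℂ) (N : Matrix (Fin n) (Fin n) ℂ)
      (A : Matrix (Fin m) (Fin n) ℂ), (wadj M N A).rank ≤ A.rank := by
    intro m n M N A
    have h1 := Matrix.rank_mul_le_left (N⁻¹ * Aᴴ) M
    have h2 := Matrix.rank_mul_le_right N⁻¹ Aᴴ
    rw [Matrix.rank_conjTranspose] at h2
    exact h1.trans h2
  apply le_antisymm (key M N A)
  have := key N M (wadj M N A)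
  rwa [wadj_wadj' M N hM hMu hN hNu] at this

lemma range_fac {m n p : ℕ} (C : Matrix (Fin m) (Fin n) ℂ) (D : Matrix (Fin n) (Fin p) ℂ)
    (h : (C * D).rank = C.rank) : ∃ Y : Matrix (Fin p) (Fin n) ℂ, C = C * D * Y := by
  have hle : LinearMap.range (C * D).mulVecLin ≤ LinearMap.range C.mulVecLin := by
    rw [Matrix.mulVecLin_mul]; exact LinearMap.range_comp_le_range _ _
  have heq := Submodule.eq_of_le_of_finrank_eq hle h
  have hc : ∀ j, ∃ y : Fin p → ℂ, (C * D) *ᵥ y = C.col j := by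
    intro j
    have : C.col j ∈ LinearMap.range C.mulVecLin := ⟨Pi.single j 1, by simp⟩
    rw [← heq] at this
    exact this
  choose y hy using hc
  refine ⟨Matrix.of fun i j => y j i, ?_⟩
  ext i j
  exact (congrFun (hy j) i).symm

theorem stmt_0 {m n : ℕ} (M : Matrix (Fin m) (Fin m) ℂ) (N : Matrix (Fin n) (Fin n) ℂ)
    (hM : M.IsHermitian) (hMu : IsUnit M) (hN : N.IsHermitian) (hNu : IsUnit N)
    (A : Matrix (Fin m) (Fin n) ℂ) :
    (∃! X, IsWMP M N A X) ↔
      A.rank = (A * wadj M N A).rank ∧ A.rank = (wadj M N A * A).rank := by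
  have hr := wadj_rank' M N hM hMu hN hNu A
  constructor
  · rintro ⟨X, ⟨h1, h2, h3, h4⟩, -⟩
    constructor
    · apply le_antisymm _ (Matrix.rank_mul_le_left _ _)
      have e : wadj M N A = X * (A * wadj M N A) := by
        conv_lhs => rw [← h1, Matrix.mul_assoc, wadj_mul' M N N hNu, h4]
        rw [Matrix.mul_assoc]
      rw [← hr]
      conv_lhs => rw [e]
      exact Matrix.rank_mul_le_right _ _
    · apply le_antisymm _ (Matrix.rank_mul_le_right _ _)
      have e : wadj M N A = wadj M N A * A * X := by
        conv_lhs => rw [← h1, wadj_mul' M M N hMu, h3]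
        rw [Matrix.mul_assoc]
      rw [← hr]
      conv_lhs => rw [e]
      exact Matrix.rank_mul_le_left _ _
  · rintro ⟨r1, r2⟩
    obtain ⟨Y, hY⟩ := range_fac A (wadj M N A) r1.symm
    obtain ⟨W, hW⟩ := range_fac (wadj M N A) A (by rw [hr, r2])
    have hA := wadj_wadj' M N hM hMu hN hNu A
    have hW' : wadj N M W * wadj M N A * A = A := by
      have := congrArg (wadj N M) hW
      rw [wadj_mul' N N M hNu, wadj_mul' N M N hMu, hA, ← Matrix.mul_assoc] at this
      exact this.symm
    have hY' : wadj M N Y * A * wadj M N A = wadj M N A := by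
      have := congrArg (wadj M N) hY
      rw [wadj_mul' M M N hMu, wadj_mul' M N M hNu, hA, ← Matrix.mul_assoc] at this
      exact this.symm
    have hYY := wadj_wadj' M M hM hMu hM hMu
    have hNN := wadj_wadj' N N hN hNu hN hNu
    have a1 : wadj M M (A * W) = wadj N M W * wadj M N A := wadj_mul' M N M hNu _ _
    have a2 : wadj M M (A * W) * (A * W) = A * W := by
      rw [a1, ← Matrix.mul_assoc, hW']
    have a3 : wadj M M (A * W) = A * W := by
      have := congrArg (wadj M M) a2
      rw [wadj_mul' M M M hMu, hYY, a2] at this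
      exact this.symm
    have a4 : A * W * A = A := by rw [← a3, a1, hW']
    obtain ⟨V, hV⟩ : ∃ V, V = wadj M N Y := ⟨_, rfl⟩
    have hVY : wadj N M V = Y := by
      rw [hV]; exact wadj_wadj' M N hM hMu hN hNu Y
    rw [← hV] at hY'
    have b1 : wadj N N (V * A) = wadj M N A * Y := by
      rw [wadj_mul' N M N hMu, hVY]
    have b2 : (V * A) * wadj N N (V * A) = wadj N N (V * A) := by
      rw [b1, ← Matrix.mul_assoc, hY']
    have b3 : wadj N N (V * A) = V * A := by
      have := congrArg (wadj N N) b2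
      rw [wadj_mul' N N N hNu, hNN, b2] at this
      exact this
    have b4 : A * V * A = A := by
      rw [Matrix.mul_assoc, ← b3, b1, ← Matrix.mul_assoc, ← hY]
    have c1 : A * (V * A * W) = A * W := by
      rw [← Matrix.mul_assoc, ← Matrix.mul_assoc, b4]
    have c2 : (V * A * W) * A = V * A := by
      rw [Matrix.mul_assoc, Matrix.mul_assoc, ← Matrix.mul_assoc A, a4]
    refine ⟨V * A * W, ⟨?_, ?_, ?_, ?_⟩, ?_⟩
    · rw [c1, a4]
    · rw [c2, Matrix.mul_assoc, c1, ← Matrix.mul_assoc]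
    · rw [c1, a3]
    · rw [c2, b3]
    · have huniq : ∀ X Z, IsWMP M N A X → IsWMP M N A Z → X = Z := by
        rintro X Z ⟨x1, x2, x3, x4⟩ ⟨z1, z2, z3, z4⟩
        have d1 : A * X = A * Z := by
          have e : A * Z * (A * X) = A * X := by rw [← Matrix.mul_assoc, z1]
          have := congrArg (wadj M M) e
          rw [wadj_mul' M M M hMu, x3, z3, ← Matrix.mul_assoc, x1] at this
          exact this.symm
        have d2 : X * A = Z * A := by
          have e : X * A * (Z * A) = X * A := by
            rw [Matrix.mul_assoc, ← Matrix.mul_assoc A, z1]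
          have := congrArg (wadj N N) e
          rw [wadj_mul' N N N hNu, x4, z4, Matrix.mul_assoc, ← Matrix.mul_assoc A, x1] at this
          exact this.symm
        rw [← x2, Matrix.mul_assoc, d1, ← Matrix.mul_assoc, d2, z2]
      intro Z hZ
      apply huniq Z _ hZ
      refine ⟨?_, ?_, ?_, ?_⟩
      · rw [c1, a4]
      · rw [c2, Matrix.mul_assoc, c1, ← Matrix.mul_assoc]
      · rw [c1, a3]
      · rw [c2, b3]
end

section
/- Let A, B, C, D be complex matrices of suitable sizes with weights making A^[†] exist. Then rank([[A^[*] A A^[*], A^[*] B],[C A^[*], D]]) = rank(A) + rank(D − C A^[†] B). -/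
open Matrix

theorem rank_blockdiag_aux {a b c d : ℕ} (P : Matrix (Fin a) (Fin b) ℂ)
    (Q : Matrix (Fin c) (Fin d) ℂ) :
    (Matrix.fromBlocks P 0 0 Q).rank = P.rank + Q.rank := by
  let e := (LinearEquiv.sumArrowLequivProdArrow (Fin a) (Fin c) ℂ ℂ).symm
  let g : (LinearMap.range P.mulVecLin × LinearMap.range Q.mulVecLin) →ₗ[ℂ] (Fin a ⊕ Fin c → ℂ) :=
    e.toLinearMap ∘ₗ ((LinearMap.range P.mulVecLin).subtype.prodMap
      (LinearMap.range Q.mulVecLin).subtype)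
  have hg : Function.Injective g := by
    refine e.injective.comp ?_
    rintro ⟨x, y⟩ ⟨x', y'⟩ h
    have ha : (x : Fin a → ℂ) = x' := congrArg Prod.fst h
    have hb : (y : Fin c → ℂ) = y' := congrArg Prod.snd h
    exact Prod.ext (Subtype.ext ha) (Subtype.ext hb)
  have hr : LinearMap.range g = LinearMap.range (Matrix.fromBlocks P 0 0 Q).mulVecLin := by
    ext v
    constructor
    · rintro ⟨⟨⟨_, x, rfl⟩, ⟨_, y, rfl⟩⟩, rfl⟩
      refine ⟨Sum.elim x y, ?_⟩
      ext i
      rcases i with i | i <;> simp [g, e, Matrix.fromBlocks_mulVec]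
    · rintro ⟨x, rfl⟩
      refine ⟨⟨⟨_, x ∘ Sum.inl, rfl⟩, ⟨_, x ∘ Sum.inr, rfl⟩⟩, ?_⟩
      ext i
      rcases i with i | i <;> simp [g, e, Matrix.fromBlocks_mulVec]
  have := LinearMap.finrank_range_of_inj hg
  rw [hr, Module.finrank_prod] at this
  exact this

theorem stmt_7 {m n k l : ℕ} (M : Matrix (Fin m) (Fin m) ℂ) (N : Matrix (Fin n) (Fin n) ℂ)
    (hM : M.IsHermitian) (hMu : IsUnit M) (hN : N.IsHermitian) (hNu : IsUnit N)
    (A : Matrix (Fin m) (Fin n) ℂ) (X : Matrix (Fin n) (Fin m) ℂ)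
    (hX : IsWMP M N A X)
    (B : Matrix (Fin m) (Fin k) ℂ) (C : Matrix (Fin l) (Fin n) ℂ)
    (D : Matrix (Fin l) (Fin k) ℂ) :
    (Matrix.fromBlocks (wadj M N A * A * wadj M N A) (wadj M N A * B)
        (C * wadj M N A) D).rank = A.rank + (D - C * X * B).rank := by
  have hMd := (Matrix.isUnit_iff_isUnit_det M).1 hMu
  have hNd := (Matrix.isUnit_iff_isUnit_det N).1 hNu
  obtain ⟨h1, h2, h3, h4⟩ := hX
  obtain ⟨S, hS⟩ : ∃ S, S = wadj M N A := ⟨_, rfl⟩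
  obtain ⟨Y, hY⟩ : ∃ Y, Y = M⁻¹ * Xᴴ * N := ⟨_, rfl⟩
  have hYS : Y * S = A * X := by
    rw [← h3, hY, hS, wadj, wadj, conjTranspose_mul]
    simp only [Matrix.mul_assoc]
    rw [Matrix.mul_nonsing_inv_cancel_left _ _ hNd]
  have hSY : S * Y = X * A := by
    rw [← h4, hY, hS, wadj, wadj, conjTranspose_mul]
    simp only [Matrix.mul_assoc]
    rw [Matrix.mul_nonsing_inv_cancel_left _ _ hMd]
  have hSYS : S * Y * S = S := by
    have h := congrArg conjTranspose h1
    simp only [conjTranspose_mul, Matrix.mul_assoc] at h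
    rw [hY, hS, wadj]
    simp only [Matrix.mul_assoc]
    rw [Matrix.mul_nonsing_inv_cancel_left _ _ hMd, Matrix.mul_nonsing_inv_cancel_left _ _ hNd,
      ← Matrix.mul_assoc Xᴴ, ← Matrix.mul_assoc Aᴴ (Xᴴ * Aᴴ), h]
  have hSAX : S * A * X = S := by rw [Matrix.mul_assoc, ← hYS, ← Matrix.mul_assoc, hSYS]
  have hXAS : X * A * S = S := by rw [← hSY, hSYS]
  have e1 : (S * A * S) * (Y * X) = S := by
    calc (S * A * S) * (Y * X) = S * A * (S * Y) * X := by simp only [Matrix.mul_assoc]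
      _ = S * (A * X * A) * X := by rw [hSY]; simp only [Matrix.mul_assoc]
      _ = S := by rw [h1, hSAX]
  have e2 : (X * Y) * (S * A * S) = S := by
    calc (X * Y) * (S * A * S) = X * (Y * S) * A * S := by simp only [Matrix.mul_assoc]
      _ = X * (A * X * A) * S := by rw [hYS]; simp only [Matrix.mul_assoc]
      _ = S := by rw [h1, hXAS]
  have e3 : S * (Y * X) = X := by rw [← Matrix.mul_assoc, hSY, h2]
  have e4 : Y * (S * A * S) * Y = A := by
    calc Y * (S * A * S) * Y = (Y * S) * A * (S * Y) := by simp only [Matrix.mul_assoc]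
      _ = A := by rw [hYS, hSY, h1, ← Matrix.mul_assoc, h1]
  have hrk : (S * A * S).rank = A.rank := by
    apply le_antisymm
    · exact (rank_mul_le_left _ _).trans (rank_mul_le_right _ _)
    · conv_lhs => rw [← e4]
      exact (rank_mul_le_left _ _).trans (rank_mul_le_right _ _)
  rw [← hS]
  have key : Matrix.fromBlocks (S * A * S) (S * B) (C * S) D
      = (Matrix.fromBlocks 1 0 (C * (X * Y)) 1 : Matrix (Fin n ⊕ Fin l) (Fin n ⊕ Fin l) ℂ)
        * Matrix.fromBlocks (S * A * S) 0 0 (D - C * X * B)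
        * (Matrix.fromBlocks 1 (Y * X * B) 0 1 : Matrix (Fin m ⊕ Fin k) (Fin m ⊕ Fin k) ℂ) := by
    have f1 : S * A * S * (Y * X * B) = S * B := by rw [← Matrix.mul_assoc, e1]
    have f2 : C * (X * Y) * (S * A * S) = C * S := by rw [Matrix.mul_assoc, e2]
    have f3 : C * S * (Y * X * B) = C * X * B := by
      rw [← Matrix.mul_assoc, Matrix.mul_assoc C, e3]
    simp only [Matrix.fromBlocks_multiply, Matrix.one_mul, Matrix.mul_one, Matrix.zero_mul,
      Matrix.mul_zero, add_zero, zero_add, f1, f2, f3, add_sub_cancel]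
  rw [key, rank_mul_eq_left_of_isUnit_det _ _ (by simp),
    rank_mul_eq_right_of_isUnit_det _ _ (by simp), rank_blockdiag_aux, hrk]
end
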